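/- Fix N ≥ 1 and a diagonal matrix D = diag(d_1,…,d_N) such that d_i − d_j is a positive integer whenever i < j. Let a, b : Δ* → (strictly upper triangular N×N complex matrices) be holomorphic on a punctured disk Δ* and satisfy the flatness equation db/dz − Y(a) + [a,b] = 0. For z ∈ Δ* and v ∈ ℂ define γ(z,v) = Te^{∫_0^v u^Y(b(z)) du/u}, the time-ordered exponential along the straight path u = tv, t ∈ [0,1], of the 1-form Σ_{n≥1} u^{n−1} b_n(z) du. Then γ(z,v) is a unipotent matrix solving the differential system Dγ = ω: namely ∂γ/∂v(z,v) = γ(z,v)·Σ_{n≥1} v^{n−1} b_n(z) and ∂γ/∂z(z,v) = γ(z,v)·v^Y(a(z)). -/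

import Mathlib

open MeasureTheory Filter Topology
noncomputable section
attribute [local instance] Matrix.normedAddCommGroup Matrix.normedSpace

/-- The graded component `x_n` of a matrix `x`, supported on the positions
`(i,j)` with `d i − d j = n`, for `D = diag d`. -/
def gpart {N : ℕ} (d : Fin N → ℂ) (n : ℕ) (x : Matrix (Fin N) (Fin N) ℂ) :
    Matrix (Fin N) (Fin N) ℂ :=
  Matrix.of fun i j => if d i - d j = (n : ℂ) then x i j else 0

/-- `u^Y(x) = Σ_n u^n x_n` (graded components with respect to `D = diag d`). -/
def uY {N : ℕ} (d : Fin N → ℂ) (u : ℂ) (x : Matrix (Fin N) (Fin N) ℂ) :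
    Matrix (Fin N) (Fin N) ℂ :=
  ∑' n : ℕ, u ^ n • gpart d n x

/-- `u^Y(x)/u = Σ_{n≥1} u^{n−1} x_n`, which is entire in `u`. -/
def uYdiv {N : ℕ} (d : Fin N → ℂ) (u : ℂ) (x : Matrix (Fin N) (Fin N) ℂ) :
    Matrix (Fin N) (Fin N) ℂ :=
  ∑' n : ℕ, u ^ n • gpart d (n + 1) x

/-- `Y(x) = [D,x] = Σ_{n≥1} n·x_n`. -/
def Yop {N : ℕ} (d : Fin N → ℂ) (x : Matrix (Fin N) (Fin N) ℂ) :
    Matrix (Fin N) (Fin N) ℂ :=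
  ∑' n : ℕ, (n : ℂ) • gpart d n x

/-- A strictly upper triangular matrix. -/
def SUT {N : ℕ} (x : Matrix (Fin N) (Fin N) ℂ) : Prop :=
  ∀ i j : Fin N, ¬ i < j → x i j = 0

/-- The derivative of a matrix-valued function, taken entrywise. -/
def matDeriv {N : ℕ} (h : ℂ → Matrix (Fin N) (Fin N) ℂ) (z : ℂ) :
    Matrix (Fin N) (Fin N) ℂ :=
  Matrix.of fun i j => deriv (fun w => h w i j) z


/-- The ordered simplex `{a ≤ s 0 ≤ s 1 ≤ ⋯ ≤ s (n-1) ≤ b}`. -/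
def orderedSimplex (n : ℕ) (a b : ℝ) : Set (Fin n → ℝ) :=
  {s | (∀ i, s i ∈ Set.Icc a b) ∧ Monotone s}

/-- `γ(z,v) = Te^{∫_0^v u^Y(b(z)) du/u}`: the time-ordered exponential, along
the straight path `u = tv`, `t ∈ [0,1]`, of the 1-form `Σ_{n≥1} u^{n−1} b_n(z) du`
(whose pullback along the path is `t ↦ v·Σ_{n≥1} (tv)^{n−1} b_n(z)`). -/
def frameSol {N : ℕ} (d : Fin N → ℂ) (b : ℂ → Matrix (Fin N) (Fin N) ℂ)
    (z v : ℂ) : Matrix (Fin N) (Fin N) ℂ :=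
  ∑' n : ℕ, ∫ s in orderedSimplex n 0 1,
    (List.ofFn fun i : Fin n => v • uYdiv d ((s i : ℂ) * v) (b z)).prod


/-- `m` is the degree attached to `d`: `m i j = d i - d j` is positive above the diagonal, and
`m i j = 0` elsewhere. -/
structure IsDegree {N : ℕ} (d : Fin N → ℂ) (m : Fin N → Fin N → ℕ) : Prop where
  pos : ∀ i j, i < j → 0 < m i j
  eq : ∀ i j, i < j → d i - d j = m i j
  zero : ∀ i j, ¬ i < j → m i j = 0

/-- Upper triangular matrices. -/
def UT {N : ℕ} (x : Matrix (Fin N) (Fin N) ℂ) : Prop :=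
  ∀ i j : Fin N, j < i → x i j = 0

theorem SUT.ut {N : ℕ} {x : Matrix (Fin N) (Fin N) ℂ} (h : SUT x) : UT x :=
  fun i j hij => h i j (not_lt_of_gt hij)

theorem UT.mul_sut {N : ℕ} {x y : Matrix (Fin N) (Fin N) ℂ} (hx : UT x) (hy : SUT y) :
    SUT (x * y) := by
  intro i j hij
  rw [Matrix.mul_apply]
  refine Finset.sum_eq_zero fun k _ => ?_
  by_cases hk : k < i
  · rw [hx i k hk, zero_mul]
  · rw [hy k j (by grind), mul_zero]

namespace IsDegree

variable {N : ℕ} {d : Fin N → ℂ} {m : Fin N → Fin N → ℕ}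

theorem eq_of_le (h : IsDegree d m) {i j : Fin N} (hij : i ≤ j) : d i - d j = m i j := by
  rcases hij.lt_or_eq with hij | rfl
  · exact h.eq i j hij
  · simp [h.zero i i (lt_irrefl i)]

theorem add (h : IsDegree d m) {i j k : Fin N} (hij : i ≤ j) (hjk : j ≤ k) :
    m i j + m j k = m i k := by
  have : ((m i j + m j k : ℕ) : ℂ) = (m i k : ℕ) := by
    push_cast
    rw [← h.eq_of_le hij, ← h.eq_of_le hjk, ← h.eq_of_le (hij.trans hjk)]
    ring
  exact_mod_cast this

theorem eq_natCast_iff (h : IsDegree d m) (i j : Fin N) (n : ℕ) :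
    d i - d j = (n : ℂ) ↔ i ≤ j ∧ m i j = n := by
  rcases le_or_gt i j with hij | hij
  · rw [h.eq_of_le hij]
    simp [hij]
  · refine ⟨fun he => ?_, fun hc => absurd hc.1 (not_le_of_gt hij)⟩
    have h1 := h.eq j i hij
    have h2 : ((n + m j i : ℕ) : ℂ) = (0 : ℕ) := by
      push_cast
      rw [← he, ← h1]
      ring
    have h3 : n + m j i = 0 := by exact_mod_cast h2
    have := h.pos j i hij
    omega

theorem gpart_apply (h : IsDegree d m) (n : ℕ) (x : Matrix (Fin N) (Fin N) ℂ) (i j : Fin N) :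
    gpart d n x i j = if i ≤ j ∧ m i j = n then x i j else 0 := by
  simp only [gpart, Matrix.of_apply, h.eq_natCast_iff]

end IsDegree

theorem tsum_matrix_apply {N : ℕ} {f : ℕ → Matrix (Fin N) (Fin N) ℂ} (K : ℕ)
    (hf : ∀ n, K ≤ n → f n = 0) (i j : Fin N) : (∑' n, f n) i j = ∑' n, f n i j := by
  rw [tsum_eq_sum (s := Finset.range K) (fun n hn => hf n (by simpa using hn)),
    tsum_eq_sum (s := Finset.range K) (fun n hn => by rw [hf n (by simpa using hn)]; rfl),
    Matrix.sum_apply]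

namespace IsDegree

variable {N : ℕ} {d : Fin N → ℂ} {m : Fin N → Fin N → ℕ}

theorem exists_gpart_eq_zero (h : IsDegree d m) (x : Matrix (Fin N) (Fin N) ℂ) :
    ∃ K, ∀ n, K ≤ n → gpart d n x = 0 := by
  refine ⟨(∑ i, ∑ j, m i j) + 1, fun n hn => ?_⟩
  ext i j
  rw [h.gpart_apply, if_neg]
  · rfl
  · rintro ⟨-, rfl⟩
    have h1 : m i j ≤ ∑ j, m i j :=
      Finset.single_le_sum (f := fun j => m i j) (fun _ _ => Nat.zero_le _) (Finset.mem_univ j)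
    have h2 : ∑ j, m i j ≤ ∑ i, ∑ j, m i j :=
      Finset.single_le_sum (f := fun i => ∑ j, m i j) (fun _ _ => Nat.zero_le _)
        (Finset.mem_univ i)
    omega

theorem tsum_smul_gpart_apply (h : IsDegree d m) (c : ℕ → ℂ) (x : Matrix (Fin N) (Fin N) ℂ)
    (i j : Fin N) :
    (∑' n, c n • gpart d n x) i j = if i ≤ j then c (m i j) * x i j else 0 := by
  obtain ⟨K, hK⟩ := h.exists_gpart_eq_zero x
  rw [tsum_matrix_apply K (fun n hn => by rw [hK n hn, smul_zero]), tsum_eq_single (m i j)]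
  · by_cases hij : i ≤ j <;> simp [h.gpart_apply, hij]
  · intro n hn
    simp [h.gpart_apply, hn.symm]

theorem uY_apply (h : IsDegree d m) (u : ℂ) (x : Matrix (Fin N) (Fin N) ℂ) (i j : Fin N) :
    uY d u x i j = if i ≤ j then u ^ m i j * x i j else 0 :=
  h.tsum_smul_gpart_apply (fun n => u ^ n) x i j

theorem Yop_apply (h : IsDegree d m) (x : Matrix (Fin N) (Fin N) ℂ) (i j : Fin N) :
    Yop d x i j = m i j * x i j := by
  refine (h.tsum_smul_gpart_apply (fun n => (n : ℂ)) x i j).trans ?_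
  split_ifs with hij
  · rfl
  · simp [h.zero i j (by grind)]

theorem uYdiv_apply (h : IsDegree d m) (u : ℂ) (x : Matrix (Fin N) (Fin N) ℂ) (i j : Fin N) :
    uYdiv d u x i j = if i < j then u ^ (m i j - 1) * x i j else 0 := by
  obtain ⟨K, hK⟩ := h.exists_gpart_eq_zero x
  rw [uYdiv, tsum_matrix_apply K (fun n hn => by rw [hK (n + 1) (by omega), smul_zero])]
  split_ifs with hij
  · have hp := h.pos i j hij
    rw [tsum_eq_single (m i j - 1)]
    · rw [Matrix.smul_apply, h.gpart_apply, if_pos ⟨hij.le, by omega⟩, smul_eq_mul]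
    · intro n hn
      rw [Matrix.smul_apply, h.gpart_apply, if_neg (by omega), smul_zero]
  · have h0 := h.zero i j hij
    refine (tsum_congr fun n => ?_).trans tsum_zero
    rw [Matrix.smul_apply, h.gpart_apply, if_neg (by omega), smul_zero]

end IsDegree

/-- Entrywise rescaling by `u ^ m i j`. -/
def gscale {N : ℕ} (m : Fin N → Fin N → ℕ) (u : ℂ) (x : Matrix (Fin N) (Fin N) ℂ) :
    Matrix (Fin N) (Fin N) ℂ :=
  Matrix.of fun i j => u ^ m i j * x i j

theorem UT.gscale {N : ℕ} {x : Matrix (Fin N) (Fin N) ℂ} (hx : UT x) (m : Fin N → Fin N → ℕ)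
    (u : ℂ) : UT (gscale m u x) := fun i j hij => by simp [_root_.gscale, hx i j hij]

theorem SUT.gscale {N : ℕ} {x : Matrix (Fin N) (Fin N) ℂ} (hx : SUT x)
    (m : Fin N → Fin N → ℕ) (u : ℂ) : SUT (gscale m u x) :=
  fun i j hij => by simp [_root_.gscale, hx i j hij]

namespace IsDegree

variable {N : ℕ} {d : Fin N → ℂ} {m : Fin N → Fin N → ℕ}

theorem uY_eq_gscale (h : IsDegree d m) (u : ℂ) {x : Matrix (Fin N) (Fin N) ℂ} (hx : UT x) :
    uY d u x = gscale m u x := by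
  ext i j
  rw [h.uY_apply]
  split_ifs with hij
  · rfl
  · simp [gscale, hx i j (by grind)]

theorem gscale_mul (h : IsDegree d m) (u : ℂ) {x y : Matrix (Fin N) (Fin N) ℂ} (hx : UT x)
    (hy : UT y) : gscale m u (x * y) = gscale m u x * gscale m u y := by
  ext i j
  simp only [gscale, Matrix.of_apply, Matrix.mul_apply, Finset.mul_sum]
  refine Finset.sum_congr rfl fun k _ => ?_
  rcases lt_or_ge k i with hk | hk
  · simp [hx i k hk]
  rcases lt_or_ge j k with hk' | hk'
  · simp [hy k j hk']
  rw [← h.add hk hk', pow_add]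
  ring

theorem gscale_mul_uYdiv_apply (h : IsDegree d m) (u : ℂ) {x y : Matrix (Fin N) (Fin N) ℂ}
    (hx : UT x) (hy : SUT y) (i j : Fin N) :
    (gscale m u x * uYdiv d u y) i j = u ^ (m i j - 1) * (x * y) i j := by
  simp only [gscale, Matrix.of_apply, Matrix.mul_apply, Finset.mul_sum, h.uYdiv_apply]
  refine Finset.sum_congr rfl fun k _ => ?_
  rcases lt_or_ge k i with hk | hk
  · simp [hx i k hk]
  split_ifs with hk'
  · have hp := h.pos k j hk'
    rw [← h.add hk hk'.le, Nat.add_sub_assoc hp, pow_add]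
    ring
  · simp [hy k j hk']

theorem smul_uYdiv_mul (h : IsDegree d m) (s v : ℂ) (x : Matrix (Fin N) (Fin N) ℂ) :
    v • uYdiv d (s * v) x = uYdiv d s (gscale m v x) := by
  ext i j
  rw [Matrix.smul_apply, h.uYdiv_apply, h.uYdiv_apply]
  split_ifs with hij
  · have hp := h.pos i j hij
    have hv : v ^ m i j = v * v ^ (m i j - 1) := by
      rw [← pow_succ', Nat.sub_add_cancel hp]
    simp only [gscale, Matrix.of_apply, smul_eq_mul, hv, mul_pow]
    ring
  · simp

end IsDegree

/-- The iterated solutions of `Y C_{n+1} = C_n b`, `C_0 = 1`. -/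
def picardCoeff {N : ℕ} (m : Fin N → Fin N → ℕ) (b : Matrix (Fin N) (Fin N) ℂ) :
    ℕ → Matrix (Fin N) (Fin N) ℂ
  | 0 => 1
  | n + 1 => Matrix.of fun i j => (picardCoeff m b n * b) i j / m i j

/-- The finite sum of the `picardCoeff`. -/
def picardSum {N : ℕ} (m : Fin N → Fin N → ℕ) (b : Matrix (Fin N) (Fin N) ℂ) :
    Matrix (Fin N) (Fin N) ℂ :=
  ∑ n ∈ Finset.range N, picardCoeff m b n

namespace IsDegree

variable {N : ℕ} {d : Fin N → ℂ} {m : Fin N → Fin N → ℕ}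

theorem picardCoeff_succ_sut (h : IsDegree d m) (b : Matrix (Fin N) (Fin N) ℂ) (n : ℕ) :
    SUT (picardCoeff m b (n + 1)) := fun i j hij => by
  simp [picardCoeff, h.zero i j hij]

theorem picardCoeff_ut (h : IsDegree d m) (b : Matrix (Fin N) (Fin N) ℂ) :
    ∀ n, UT (picardCoeff m b n)
  | 0 => fun _ _ hij => Matrix.one_apply_ne hij.ne'
  | n + 1 => (h.picardCoeff_succ_sut b n).ut

theorem picardCoeff_apply_eq_zero {b : Matrix (Fin N) (Fin N) ℂ}
    (hb : SUT b) : ∀ (n : ℕ) (i j : Fin N), (j : ℕ) < i + n → picardCoeff m b n i j = 0 := by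
  intro n
  induction n with
  | zero => exact fun i j hij => Matrix.one_apply_ne (by rintro rfl; omega)
  | succ n ih =>
    intro i j hij
    rw [picardCoeff, Matrix.of_apply, Matrix.mul_apply, Finset.sum_eq_zero, zero_div]
    intro k _
    by_cases hk : (k : ℕ) < i + n
    · rw [ih i k hk, zero_mul]
    · rw [hb k j (by rw [Fin.lt_def]; omega), mul_zero]

theorem picardCoeff_eq_zero {b : Matrix (Fin N) (Fin N) ℂ} (hb : SUT b) {n : ℕ}
    (hn : N ≤ n) : picardCoeff m b n = 0 := by
  ext i j
  exact picardCoeff_apply_eq_zero hb n i j (by omega)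

theorem degree_mul_picardCoeff_succ (h : IsDegree d m) {b : Matrix (Fin N) (Fin N) ℂ}
    (hb : SUT b) (n : ℕ) (i j : Fin N) :
    m i j * picardCoeff m b (n + 1) i j = (picardCoeff m b n * b) i j := by
  by_cases hij : i < j
  · have hp : (m i j : ℂ) ≠ 0 := by exact_mod_cast (h.pos i j hij).ne'
    rw [picardCoeff, Matrix.of_apply, mul_div_cancel₀ _ hp]
  · rw [h.zero i j hij, (h.picardCoeff_ut b n).mul_sut hb i j hij]
    simp

theorem picardSum_ut (h : IsDegree d m) (b : Matrix (Fin N) (Fin N) ℂ) :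
    UT (picardSum m b) := fun i j hij => by
  rw [picardSum, Matrix.sum_apply]
  exact Finset.sum_eq_zero fun n _ => h.picardCoeff_ut b n i j hij

theorem picardSum_diag (h : IsDegree d m) (b : Matrix (Fin N) (Fin N) ℂ) (i : Fin N) :
    picardSum m b i i = 1 := by
  obtain ⟨K, rfl⟩ : ∃ K, N = K + 1 := ⟨N - 1, by have := i.pos; omega⟩
  rw [picardSum, Matrix.sum_apply, Finset.sum_range_succ', Finset.sum_eq_zero, zero_add]
  · exact Matrix.one_apply_eq i
  · exact fun n _ => h.picardCoeff_succ_sut b n i i (lt_irrefl i)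

theorem degree_mul_picardSum (h : IsDegree d m) {b : Matrix (Fin N) (Fin N) ℂ}
    (hb : SUT b) (i j : Fin N) :
    m i j * picardSum m b i j = (picardSum m b * b) i j := by
  have h0 : (m i j : ℂ) * picardCoeff m b 0 i j = 0 := by
    by_cases hij : i = j
    · simp [hij, h.zero j j (lt_irrefl j)]
    · simp [picardCoeff, hij]
  have hN : (m i j : ℂ) * picardCoeff m b N i j = 0 := by
    rw [picardCoeff_eq_zero hb le_rfl, Matrix.zero_apply, mul_zero]
  rw [picardSum, Matrix.sum_mul, Matrix.sum_apply, Matrix.sum_apply, Finset.mul_sum]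
  simp only [← h.degree_mul_picardCoeff_succ hb]
  have h1 := Finset.sum_range_succ (fun n => (m i j : ℂ) * picardCoeff m b n i j) N
  rw [Finset.sum_range_succ', h0, hN] at h1
  simpa using h1.symm

theorem picardCoeff_gscale (h : IsDegree d m) (v : ℂ) {b : Matrix (Fin N) (Fin N) ℂ}
    (hb : SUT b) (n : ℕ) : picardCoeff m (gscale m v b) n = gscale m v (picardCoeff m b n) := by
  induction n with
  | zero =>
    ext i j
    by_cases hij : i = j
    · subst hij
      simp [gscale, picardCoeff, h.zero i i (lt_irrefl i)]
    · simp [gscale, picardCoeff, hij]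
  | succ n ih =>
    ext i j
    rw [picardCoeff, Matrix.of_apply, ih, ← h.gscale_mul v (h.picardCoeff_ut b n) hb.ut]
    simp only [gscale, picardCoeff, Matrix.of_apply, mul_div_assoc]

/-- A strictly upper triangular solution of `Y x = x b` vanishes. -/
theorem eq_zero_of_degree_mul_eq (h : IsDegree d m) {x b : Matrix (Fin N) (Fin N) ℂ}
    (hx : SUT x) (hb : SUT b) (hxb : ∀ i j, m i j * x i j = (x * b) i j) : x = 0 := by
  have key : ∀ (n : ℕ) (i j : Fin N), (j : ℕ) < n → x i j = 0 := by
    intro n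
    induction n with
    | zero => exact fun i j hj => absurd hj (Nat.not_lt_zero _)
    | succ n ih =>
      intro i j hj
      by_cases hij : i < j
      · have hp : (m i j : ℂ) ≠ 0 := by exact_mod_cast (h.pos i j hij).ne'
        have h0 : (x * b) i j = 0 := by
          rw [Matrix.mul_apply]
          refine Finset.sum_eq_zero fun k _ => ?_
          by_cases hk : k < j
          · rw [ih i k (by rw [Fin.lt_def] at hk; omega), zero_mul]
          · rw [hb k j hk, mul_zero]
        rw [← hxb] at h0
        exact (mul_eq_zero.mp h0).resolve_left hp
      · exact hx i j hij
  ext i j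
  exact key N i j j.isLt

theorem differentiableAt_picardCoeff {b : ℂ → Matrix (Fin N) (Fin N) ℂ} {z : ℂ}
    (hb : ∀ i j, DifferentiableAt ℂ (fun w => b w i j) z) (n : ℕ) (i j : Fin N) :
    DifferentiableAt ℂ (fun w => picardCoeff m (b w) n i j) z := by
  induction n generalizing i j with
  | zero => exact differentiableAt_const _
  | succ n ih =>
    simp only [picardCoeff, Matrix.of_apply, Matrix.mul_apply]
    exact (DifferentiableAt.fun_sum fun k _ => (ih i k).mul (hb k j)).div_const _

theorem differentiableAt_picardSum {b : ℂ → Matrix (Fin N) (Fin N) ℂ} {z : ℂ}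
    (hb : ∀ i j, DifferentiableAt ℂ (fun w => b w i j) z) (i j : Fin N) :
    DifferentiableAt ℂ (fun w => picardSum m (b w) i j) z := by
  simp only [picardSum, Matrix.sum_apply]
  exact DifferentiableAt.fun_sum fun n _ => differentiableAt_picardCoeff hb n i j

theorem matDeriv_picardSum (h : IsDegree d m) {a : Matrix (Fin N) (Fin N) ℂ}
    {b : ℂ → Matrix (Fin N) (Fin N) ℂ} {z : ℂ}
    (hb : ∀ i j, DifferentiableAt ℂ (fun w => b w i j) z) (hsa : SUT a)
    (hsb : ∀ᶠ w in 𝓝 z, SUT (b w))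
    (hflat : matDeriv b z - Yop d a + (a * b z - b z * a) = 0) :
    matDeriv (fun w => picardSum m (b w)) z = picardSum m (b z) * a := by
  set C := picardSum m (b z)
  set C' := matDeriv (fun w => picardSum m (b w)) z
  have hbz : SUT (b z) := hsb.self_of_nhds
  have hCd (i j : Fin N) : HasDerivAt (fun w => picardSum m (b w) i j) (C' i j) z :=
    (differentiableAt_picardSum hb i j).hasDerivAt
  have hbd (i j : Fin N) : HasDerivAt (fun w => b w i j) (matDeriv b z i j) z :=
    (hb i j).hasDerivAt
  have hYC (i j : Fin N) : m i j * C i j = (C * b z) i j := h.degree_mul_picardSum hbz i j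
  have hYC' (i j : Fin N) : m i j * C' i j = (C' * b z + C * matDeriv b z) i j := by
    have h1 : HasDerivAt (fun w => (m i j : ℂ) * picardSum m (b w) i j) (m i j * C' i j) z :=
      (hCd i j).const_mul _
    have h2 : HasDerivAt (fun w => ∑ k, picardSum m (b w) i k * b w k j)
        (∑ k, (C' i k * b z k j + C i k * matDeriv b z k j)) z :=
      HasDerivAt.fun_sum fun k _ => (hCd i k).mul (hbd k j)
    have h3 : (fun w => (m i j : ℂ) * picardSum m (b w) i j) =ᶠ[𝓝 z]
        fun w => ∑ k, picardSum m (b w) i k * b w k j := by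
      filter_upwards [hsb] with w hw
      rw [h.degree_mul_picardSum hw, Matrix.mul_apply]
    rw [h1.unique (h2.congr_of_eventuallyEq h3), Finset.sum_add_distrib]
    rfl
  have hUC : UT C := h.picardSum_ut (b z)
  have hdb : matDeriv b z = Yop d a - (a * b z - b z * a) := by
    rw [← sub_eq_zero, ← hflat]; abel
  have hYmul (i j : Fin N) :
      m i j * (C * a) i j = (C * b z * a + C * Yop d a) i j := by
    simp only [Matrix.add_apply, Matrix.mul_apply (M := C * b z), Matrix.mul_apply (M := C)
      (N := a), Matrix.mul_apply (M := C) (N := Yop d a), Finset.mul_sum, ← hYC, h.Yop_apply,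
      ← Finset.sum_add_distrib]
    refine Finset.sum_congr rfl fun k _ => ?_
    rcases lt_or_ge k i with hk | hk
    · simp [hUC i k hk]
    by_cases hk' : k < j
    · rw [← h.add hk hk'.le]
      push_cast
      ring
    · simp [hsa k j hk']
  have hSC' : SUT C' := by
    intro i j hij
    refine (hCd i j).unique ?_
    have : (fun w => picardSum m (b w) i j) = fun _ => if i = j then 1 else 0 := by
      funext w
      split_ifs with hij'
      · rw [hij', h.picardSum_diag]
      · exact h.picardSum_ut _ i j (by grind)
    rw [this]
    exact hasDerivAt_const _ _
  have hSX : SUT (C' - C * a) := fun i j hij => by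
    rw [Matrix.sub_apply, hSC' i j hij, hUC.mul_sut hsa i j hij, sub_zero]
  refine sub_eq_zero.mp (h.eq_zero_of_degree_mul_eq hSX hbz fun i j => ?_)
  rw [Matrix.sub_apply, mul_sub, hYC', hYmul, ← Matrix.sub_apply, hdb]
  suffices hE : C' * b z + C * (Yop d a - (a * b z - b z * a)) - (C * b z * a + C * Yop d a) =
      (C' - C * a) * b z from congrArg (fun x : Matrix (Fin N) (Fin N) ℂ => x i j) hE
  simp only [mul_sub, sub_mul, mul_assoc]
  abel

end IsDegree

section OrderedIntegral

variable {N : ℕ} {n : ℕ} {T : ℝ}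

theorem isCompact_orderedSimplex (n : ℕ) (a b : ℝ) : IsCompact (orderedSimplex n a b) := by
  have h : orderedSimplex n a b =
      (Set.univ.pi fun _ => Set.Icc a b) ∩ {s | ∀ i j, i ≤ j → s i ≤ s j} := by
    ext s
    simp only [orderedSimplex, Monotone, Set.mem_inter_iff, Set.mem_univ_pi, Set.mem_ofPred_eq]
  rw [h]
  refine (isCompact_univ_pi fun _ => isCompact_Icc).inter_right ?_
  simp only [Set.ofPred_forall]
  exact isClosed_iInter fun i => isClosed_iInter fun j => isClosed_iInter fun _ =>
    isClosed_le (continuous_apply i) (continuous_apply j)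

theorem continuous_prod_ofFn {M : ℝ → Matrix (Fin N) (Fin N) ℂ} (hM : Continuous M) :
    ∀ n : ℕ, Continuous fun s : Fin n → ℝ => (List.ofFn fun i => M (s i)).prod
  | 0 => by simpa using continuous_const
  | n + 1 => by
    simp only [List.ofFn_succ, List.prod_cons]
    exact (hM.comp (continuous_apply 0)).matrix_mul
      ((continuous_prod_ofFn hM n).comp (continuous_pi fun i => continuous_apply i.succ))

theorem insertNth_last_mem_orderedSimplex {t : ℝ} {s : Fin n → ℝ} :
    (Fin.insertNth (α := fun _ => ℝ) (Fin.last n) t s) ∈ orderedSimplex (n + 1) 0 T ↔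
      t ∈ Set.Icc 0 T ∧ s ∈ orderedSimplex n 0 t := by
  rw [Fin.insertNth_last']
  constructor
  · rintro ⟨h1, h2⟩
    refine ⟨by simpa using h1 (Fin.last n), fun i => ⟨?_, ?_⟩, fun i j hij => ?_⟩
    · simpa using (h1 i.castSucc).1
    · simpa using h2 (Fin.le_last i.castSucc)
    · simpa using h2 (Fin.castSucc_le_castSucc_iff.mpr hij)
  · rintro ⟨ht, h1, h2⟩
    refine ⟨fun i => ?_, fun i j hij => ?_⟩
    · induction i using Fin.lastCases with
      | last => simpa using ht
      | cast i => simpa using ⟨(h1 i).1, (h1 i).2.trans ht.2⟩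
    · induction j using Fin.lastCases with
      | last =>
        induction i using Fin.lastCases with
        | last => exact le_rfl
        | cast i => simpa using (h1 i).2
      | cast j =>
        induction i using Fin.lastCases with
        | last => exact absurd hij (not_le_of_gt (Fin.castSucc_lt_last j))
        | cast i => simpa using h2 (Fin.castSucc_le_castSucc_iff.mp hij)

theorem integral_orderedSimplex_succ {M : ℝ → Matrix (Fin N) (Fin N) ℂ} (hM : Continuous M)
    (n : ℕ) (T : ℝ) :
    ∫ s in orderedSimplex (n + 1) 0 T, (List.ofFn fun i => M (s i)).prod =
      ∫ t in Set.Icc 0 T,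
        (∫ s in orderedSimplex n 0 t, (List.ofFn fun i => M (s i)).prod) * M t := by
  have hmeas (k : ℕ) (t : ℝ) : MeasurableSet (orderedSimplex k 0 t) :=
    (isCompact_orderedSimplex k 0 t).isClosed.measurableSet
  set F : (Fin (n + 1) → ℝ) → Matrix (Fin N) (Fin N) ℂ :=
    fun s => (List.ofFn fun i => M (s i)).prod
  have hint := ((continuous_prod_ofFn hM (n + 1)).continuousOn.integrableOn_compact
    (μ := volume) (isCompact_orderedSimplex (n + 1) 0 T)).integrable_indicator (hmeas _ _)
  have hmp := (volume_preserving_piFinSuccAbove (fun _ : Fin (n + 1) => ℝ) (Fin.last n)).symm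
  rw [← integral_indicator (hmeas _ _), ← hmp.integral_comp', Measure.volume_eq_prod,
    ← integral_indicator measurableSet_Icc]
  refine (integral_prod _ (hmp.integrable_comp_of_integrable hint)).trans ?_
  refine integral_congr_ae (.of_forall fun t => ?_)
  have hpt (s : Fin n → ℝ) : (orderedSimplex (n + 1) 0 T).indicator F
      ((MeasurableEquiv.piFinSuccAbove (fun _ : Fin (n + 1) => ℝ) (Fin.last n)).symm (t, s)) =
      (Set.Icc 0 T).indicator (fun t => (orderedSimplex n 0 t).indicator
        (fun s => (List.ofFn fun i => M (s i)).prod * M t) s) t := by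
    change (orderedSimplex (n + 1) 0 T).indicator F
      (Fin.insertNth (α := fun _ => ℝ) (Fin.last n) t s) = _
    have hmem := insertNth_last_mem_orderedSimplex (n := n) (T := T) (t := t) (s := s)
    by_cases ht : t ∈ Set.Icc 0 T
    · rw [Set.indicator_of_mem ht]
      by_cases hs : s ∈ orderedSimplex n 0 t
      · rw [Set.indicator_of_mem hs, Set.indicator_of_mem (hmem.mpr ⟨ht, hs⟩)]
        simp only [F]
        rw [List.ofFn_succ', List.concat_eq_append, List.prod_append, List.prod_singleton]
        simp only [Fin.insertNth_last', Fin.snoc_castSucc, Fin.snoc_last]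
      · rw [Set.indicator_of_notMem hs, Set.indicator_of_notMem fun hc => hs (hmem.mp hc).2]
    · rw [Set.indicator_of_notMem ht, Set.indicator_of_notMem fun hc => ht (hmem.mp hc).1]
  refine (integral_congr_ae (.of_forall hpt)).trans ?_
  by_cases ht : t ∈ Set.Icc 0 T
  · simp only [Set.indicator_of_mem ht]
    rw [integral_indicator (hmeas _ _)]
    exact (LinearMap.toContinuousLinearMap (LinearMap.mulRight ℂ (M t))).integral_comp_comm
      ((continuous_prod_ofFn hM n).continuousOn.integrableOn_compact
        (isCompact_orderedSimplex n 0 t))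
  · simp [Set.indicator_of_notMem ht]

end OrderedIntegral

theorem integral_Icc_matrix_apply {N : ℕ} {f : ℝ → Matrix (Fin N) (Fin N) ℂ}
    (hf : Continuous f) (a b : ℝ) (i j : Fin N) :
    (∫ t in Set.Icc a b, f t) i j = ∫ t in Set.Icc a b, f t i j :=
  ((LinearMap.toContinuousLinearMap (Matrix.entryLinearMap ℂ ℂ i j)).integral_comp_comm
    (hf.continuousOn.integrableOn_compact isCompact_Icc)).symm

namespace IsDegree

variable {N : ℕ} {d : Fin N → ℂ} {m : Fin N → Fin N → ℕ}

theorem continuous_uYdiv (h : IsDegree d m) (b : Matrix (Fin N) (Fin N) ℂ) :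
    Continuous fun t : ℝ => uYdiv d (t : ℂ) b := by
  refine continuous_matrix fun i j => ?_
  simp only [h.uYdiv_apply]
  split_ifs
  · fun_prop
  · exact continuous_const

theorem integral_orderedSimplex (h : IsDegree d m) {b : Matrix (Fin N) (Fin N) ℂ} (hb : SUT b)
    (n : ℕ) {T : ℝ} (hT : 0 ≤ T) :
    ∫ s in orderedSimplex n 0 T, (List.ofFn fun i => uYdiv d (s i : ℂ) b).prod =
      gscale m T (picardCoeff m b n) := by
  have hM := h.continuous_uYdiv b
  induction n generalizing T with
  | zero =>
    have hs : orderedSimplex 0 0 T = Set.univ :=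
      Set.eq_univ_of_forall fun s => ⟨fun i => i.elim0, fun i => i.elim0⟩
    rw [hs]
    ext i j
    by_cases hij : i = j
    · subst hij
      simp [gscale, picardCoeff, h.zero i i (lt_irrefl i), integral_unique,
        measureReal_def, volume_pi]
    · simp [gscale, picardCoeff, hij, integral_unique]
  | succ n ih =>
    rw [integral_orderedSimplex_succ hM, setIntegral_congr_fun
      (g := fun t : ℝ => gscale m t (picardCoeff m b n) * uYdiv d (t : ℂ) b) measurableSet_Icc
      fun t ht => by simp only [ih ht.1]]
    have hcont : Continuous fun t : ℝ => gscale m t (picardCoeff m b n) * uYdiv d (t : ℂ) b := by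
      refine Continuous.matrix_mul (continuous_matrix fun i j => ?_) hM
      simp only [gscale, Matrix.of_apply]
      fun_prop
    ext i j
    rw [integral_Icc_matrix_apply hcont]
    simp only [h.gscale_mul_uYdiv_apply _ (h.picardCoeff_ut b n) hb]
    simp only [gscale, picardCoeff, Matrix.of_apply]
    rw [integral_mul_const, integral_Icc_eq_integral_Ioc, ← intervalIntegral.integral_of_le hT]
    by_cases hij : i < j
    · have hp := h.pos i j hij
      have : ∫ t in (0 : ℝ)..T, (t : ℂ) ^ (m i j - 1) = (T : ℂ) ^ m i j / m i j := by
        have := integral_pow (a := 0) (b := T) (m i j - 1)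
        simp only [← Complex.ofReal_pow]
        rw [intervalIntegral.integral_ofReal, this]
        have h1 : m i j - 1 + 1 = m i j := by omega
        have h2 : ((m i j - 1 : ℕ) : ℝ) + 1 = m i j := by exact_mod_cast h1
        rw [h1, h2, zero_pow hp.ne']
        push_cast
        ring
      rw [this]
      ring
    · rw [(h.picardCoeff_ut b n).mul_sut hb i j hij]
      simp

theorem frameSol_eq (h : IsDegree d m) {b : ℂ → Matrix (Fin N) (Fin N) ℂ} {z : ℂ}
    (hb : SUT (b z)) (v : ℂ) : frameSol d b z v = gscale m v (picardSum m (b z)) := by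
  simp only [frameSol, h.smul_uYdiv_mul]
  simp only [h.integral_orderedSimplex (hb.gscale m v) _ zero_le_one, h.picardCoeff_gscale v hb]
  have h1 (x : Matrix (Fin N) (Fin N) ℂ) : gscale m ((1 : ℝ) : ℂ) x = x := by
    ext i j
    simp [gscale]
  simp only [h1]
  rw [tsum_eq_sum (s := Finset.range N)]
  · ext i j
    simp [gscale, picardSum, Matrix.sum_apply, Finset.mul_sum]
  · intro n hn
    rw [picardCoeff_eq_zero hb (by simpa using hn)]
    ext i j
    simp [gscale]

end IsDegree

/-- For a flat connection `ω = u^Y(a) dz + u^Y(b) du/u`, the section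
`γ(z,v) = Te^{∫_0^v u^Y(b(z)) du/u}` is a unipotent matrix solving `Dγ = ω`:
`∂γ/∂v = γ·Σ_{n≥1} v^{n−1} b_n(z)` and `∂γ/∂z = γ·v^Y(a(z))`. -/
theorem stmt10 {N : ℕ} (hN : 1 ≤ N) (d : Fin N → ℂ)
    (hd : ∀ i j : Fin N, i < j → ∃ n : ℕ, 0 < n ∧ d i - d j = (n : ℂ))
    (r : ℝ) (hr : 0 < r) (a b : ℂ → Matrix (Fin N) (Fin N) ℂ)
    (ha : ∀ z ∈ Metric.ball (0 : ℂ) r \ {0}, ∀ i j,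
      DifferentiableAt ℂ (fun w => a w i j) z)
    (hb : ∀ z ∈ Metric.ball (0 : ℂ) r \ {0}, ∀ i j,
      DifferentiableAt ℂ (fun w => b w i j) z)
    (hsa : ∀ z ∈ Metric.ball (0 : ℂ) r \ {0}, SUT (a z))
    (hsb : ∀ z ∈ Metric.ball (0 : ℂ) r \ {0}, SUT (b z))
    (hflat : ∀ z ∈ Metric.ball (0 : ℂ) r \ {0},
      matDeriv b z - Yop d (a z) + (a z * b z - b z * a z) = 0) :
    ∀ z ∈ Metric.ball (0 : ℂ) r \ {0}, ∀ v : ℂ,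
      ((∀ i j : Fin N, j < i → frameSol d b z v i j = 0) ∧
        (∀ i : Fin N, frameSol d b z v i i = 1)) ∧
      (∀ i j : Fin N, HasDerivAt (fun w => frameSol d b z w i j)
        ((frameSol d b z v * uYdiv d v (b z)) i j) v) ∧
      (∀ i j : Fin N, HasDerivAt (fun w => frameSol d b w v i j)
        ((frameSol d b z v * uY d v (a z)) i j) z) := by
  classical
  obtain ⟨m, hm⟩ : ∃ m, IsDegree d m := by
    choose f hf hfd using hd
    refine ⟨fun i j => if hij : i < j then f i j hij else 0, fun i j hij => ?_,
      fun i j hij => ?_, fun i j hij => ?_⟩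
    · simpa [hij] using hf i j hij
    · simpa [hij] using hfd i j hij
    · simp [hij]
  intro z hz v
  have hbz := hsb z hz
  have hU := hm.picardSum_ut (b z)
  have hnhds : Metric.ball (0 : ℂ) r \ {0} ∈ 𝓝 z :=
    (Metric.isOpen_ball.sdiff isClosed_singleton).mem_nhds hz
  refine ⟨⟨fun i j hij => ?_, fun i => ?_⟩, fun i j => ?_, fun i j => ?_⟩
  · rw [hm.frameSol_eq hbz]
    exact hU.gscale m v i j hij
  · rw [hm.frameSol_eq hbz]
    simp [gscale, hm.picardSum_diag, hm.zero i i (lt_irrefl i)]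
  · simp only [hm.frameSol_eq hbz]
    rw [hm.gscale_mul_uYdiv_apply v hU hbz, ← hm.degree_mul_picardSum hbz]
    simp only [gscale, Matrix.of_apply]
    exact ((hasDerivAt_pow (m i j) v).mul_const (picardSum m (b z) i j)).congr_deriv (by ring)
  · rw [hm.frameSol_eq hbz, hm.uY_eq_gscale v (hsa z hz).ut, ← hm.gscale_mul v hU (hsa z hz).ut,
      ← hm.matDeriv_picardSum (hb z hz) (hsa z hz)
        (Filter.eventually_of_mem hnhds hsb) (hflat z hz)]
    refine (((IsDegree.differentiableAt_picardSum (hb z hz) i j).hasDerivAt).const_mul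
      (v ^ m i j)).congr_of_eventuallyEq ?_
    filter_upwards [hnhds] with w hw
    rw [hm.frameSol_eq (hsb w hw)]
    rfl
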